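/- arXiv:quant-ph/0409026 — 2 statements merged into one kernel-verified Lean document; each statement's English description precedes it below -/
import Mathlib

section
/- For every N×N complex matrix M there exists an N×N unitary matrix V such that all diagonal entries of V M V* are equal; equivalently, (V M V*)_{kk} = Tr(M)/N for every k = 1, …, N. -/
open Matrix

/-- A traceless `2 × 2` sesquilinear form over `ℂ` has a nonzero isotropic vector. -/
lemma exists_isotropic_of_traceless (a b c : ℂ) :
    ∃ x y : ℂ, (x ≠ 0 ∨ y ≠ 0) ∧
      x * star x * a + x * star y * b + y * star x * c - y * star y * a = 0 := by
  by_cases ha : a = 0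
  · exact ⟨1, 0, by simp [ha]⟩
  obtain ⟨w, hw, r, hr⟩ : ∃ w : ℂ, w ≠ 0 ∧ ∃ r : ℝ, star w * b + w * c = r * a := by
    suffices h : ∃ w : ℂ, w ≠ 0 ∧ (star w * (b / a) + w * (c / a)).im = 0 by
      obtain ⟨w, hw, h⟩ := h
      refine ⟨w, hw, (star w * (b / a) + w * (c / a)).re, ?_⟩
      rw [show (((star w * (b / a) + w * (c / a)).re : ℝ) : ℂ) = star w * (b / a) + w * (c / a)
        from Complex.ext (by simp) (by simp at h ⊢; linarith)]
      field_simp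
    generalize b / a = β
    generalize c / a = γ
    by_cases h : β.im + γ.im = 0 ∧ γ.re - β.re = 0
    · refine ⟨1, one_ne_zero, ?_⟩
      simpa using h.1
    · refine ⟨⟨γ.re - β.re, -(β.im + γ.im)⟩, fun h0 => h ?_, ?_⟩
      · have h1 := congrArg Complex.re h0
        have h2 := congrArg Complex.im h0
        simp only [Complex.zero_re, Complex.zero_im] at h1 h2
        exact ⟨by linarith, h1⟩
      · simp
        ring
  have hD : 0 ≤ r ^ 2 + 4 * Complex.normSq w := by
    have := Complex.normSq_nonneg w
    positivity
  have hs := Real.sq_sqrt hD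
  set s := √(r ^ 2 + 4 * Complex.normSq w)
  refine ⟨(((s - r) / 2 : ℝ) : ℂ), w, Or.inr hw, ?_⟩
  have hww : w * star w = (Complex.normSq w : ℂ) := Complex.mul_conj w
  have hx : star (((s - r) / 2 : ℝ) : ℂ) = (((s - r) / 2 : ℝ) : ℂ) := Complex.conj_ofReal _
  have hq : ((((s - r) / 2) ^ 2 + (s - r) / 2 * r - Complex.normSq w : ℝ) : ℂ) = 0 := by
    norm_cast
    linarith
  rw [hx, hww]
  push_cast at hq ⊢
  linear_combination a * hq + ((s : ℂ) - r) / 2 * hr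

/-- A unit vector at which a `2 × 2` sesquilinear form takes the mean of its diagonal values. -/
lemma exists_unit_form_eq_mean (a b c d : ℂ) :
    ∃ x y : ℂ, x * star x + y * star y = 1 ∧
      x * star x * a + x * star y * b + y * star x * c + y * star y * d = (a + d) / 2 := by
  obtain ⟨x, y, hxy, h⟩ := exists_isotropic_of_traceless ((a - d) / 2) b c
  have hpos : 0 < Complex.normSq x + Complex.normSq y := by
    rcases hxy with hx | hy
    · exact add_pos_of_pos_of_nonneg (Complex.normSq_pos.2 hx) (Complex.normSq_nonneg y)
    · exact add_pos_of_nonneg_of_pos (Complex.normSq_nonneg x) (Complex.normSq_pos.2 hy)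
  set t : ℝ := (√(Complex.normSq x + Complex.normSq y))⁻¹ with ht
  have htt : (t : ℂ) * t * (x * star x + y * star y) = 1 := by
    have hx : x * star x = (Complex.normSq x : ℂ) := Complex.mul_conj x
    have hy : y * star y = (Complex.normSq y : ℂ) := Complex.mul_conj y
    rw [hx, hy]
    norm_cast
    rw [ht, ← mul_inv, Real.mul_self_sqrt hpos.le, inv_mul_cancel₀ hpos.ne']
  have hts : star (t : ℂ) = t := Complex.conj_ofReal t
  refine ⟨t * x, t * y, ?_, ?_⟩
  · simp only [star_mul', hts]
    linear_combination htt
  · simp only [star_mul', hts]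
    linear_combination (t : ℂ) * t * h + (a + d) / 2 * htt

/-- If two diagonal entries of `V M Vᴴ` differ, they can both be replaced by their mean
by changing the unitary `V`, keeping the other diagonal entries. -/
lemma exists_unitary_average_diagonal {n : Type*} [Fintype n] [DecidableEq n]
    (M V : Matrix n n ℂ) (hV : V * Vᴴ = 1) {i j : n} (hij : i ≠ j) :
    ∃ W : Matrix n n ℂ, W * Wᴴ = 1 ∧
      (W * M * Wᴴ) i i = ((V * M * Vᴴ) i i + (V * M * Vᴴ) j j) / 2 ∧
      (W * M * Wᴴ) j j = ((V * M * Vᴴ) i i + (V * M * Vᴴ) j j) / 2 ∧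
      ∀ k, k ≠ i → k ≠ j → (W * M * Wᴴ) k k = (V * M * Vᴴ) k k := by
  have entry (A : Matrix n n ℂ) (k l : n) : (A * Aᴴ) k l = A k ⬝ᵥ star (A l) := rfl
  have entryM (A : Matrix n n ℂ) (k l : n) : (A * M * Aᴴ) k l = (A k ᵥ* M) ⬝ᵥ star (A l) := rfl
  have horth (k l : n) : V k ⬝ᵥ star (V l) = if k = l then 1 else 0 := by
    rw [← entry, hV, one_apply]
  obtain ⟨x, y, hxy, hmean⟩ := exists_unit_form_eq_mean ((V * M * Vᴴ) i i) ((V * M * Vᴴ) i j)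
    ((V * M * Vᴴ) j i) ((V * M * Vᴴ) j j)
  let W : Matrix n n ℂ := fun k => if k = i then x • V i + y • V j
    else if k = j then (-star y) • V i + star x • V j else V k
  have hWi : W i = x • V i + y • V j := by simp [W]
  have hWj : W j = (-star y) • V i + star x • V j := by simp [W, hij.symm]
  have hWk (k) (h1 : k ≠ i) (h2 : k ≠ j) : W k = V k := by simp [W, h1, h2]
  refine ⟨W, ?_, ?_, ?_, fun k h1 h2 => ?_⟩
  · ext k l
    rw [entry, one_apply]
    rcases eq_or_ne k i with rfl | hki
    · rcases eq_or_ne l k with rfl | hlk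
      · simp [hWi, horth, hij, hij.symm]
        simp only [RCLike.star_def] at hxy
        linear_combination hxy
      rcases eq_or_ne l j with rfl | hlj
      · simp [hWi, hWj, horth, hij, hij.symm]
        ring
      · simp [hWi, hWk l hlk hlj, horth, hlk.symm, hlj.symm]
    rcases eq_or_ne k j with rfl | hkj
    · rcases eq_or_ne l i with rfl | hli
      · simp [hWi, hWj, horth, hij, hij.symm]
        ring
      rcases eq_or_ne l k with rfl | hlk
      · simp [hWj, horth, hij, hij.symm]
        simp only [RCLike.star_def] at hxy
        linear_combination hxy
      · simp [hWj, hWk l hli hlk, horth, hli.symm, hlk.symm]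
    rcases eq_or_ne l i with rfl | hli
    · simp [hWi, hWk k hki hkj, horth, hki, hkj]
    rcases eq_or_ne l j with rfl | hlj
    · simp [hWj, hWk k hki hkj, horth, hki, hkj]
    · rw [hWk k hki hkj, hWk l hli hlj, horth]
  · rw [← hmean]
    simp only [entryM, hWi, add_vecMul, smul_vecMul, star_add, star_smul, add_dotProduct,
      dotProduct_add, smul_dotProduct, dotProduct_smul, smul_eq_mul]
    ring
  · simp only [entryM] at hmean
    simp only [entryM, hWj, add_vecMul, smul_vecMul, star_add, star_smul, add_dotProduct,
      dotProduct_add, smul_dotProduct, dotProduct_smul, smul_eq_mul, star_neg, star_star]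
    linear_combination ((V i ᵥ* M) ⬝ᵥ star (V i) + (V j ᵥ* M) ⬝ᵥ star (V j)) * hxy - hmean
  · rw [entryM, entryM, hWk k h1 h2]

/-- The set of unitary matrices is compact. -/
lemma isCompact_setOf_mul_conjTranspose_eq_one {n : Type*} [Fintype n] [DecidableEq n] :
    IsCompact {V : Matrix n n ℂ | V * Vᴴ = 1} := by
  have hK : IsCompact (Set.univ.pi fun _ : n => Set.univ.pi fun _ : n =>
      Metric.closedBall (0 : ℂ) 1) :=
    isCompact_univ_pi fun _ => isCompact_univ_pi fun _ => isCompact_closedBall 0 1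
  refine IsCompact.of_isClosed_subset (X := Matrix n n ℂ) hK
    (isClosed_eq (by fun_prop) continuous_const) fun V hV => ?_
  exact fun k _ l _ => mem_closedBall_zero_iff.2
    (entry_norm_bound_of_unitary (mem_unitaryGroup_iff.2 hV) k l)

/-- Every `N × N` complex matrix is unitarily similar to a matrix
with constant diagonal: there is a unitary `V` with
`(V * M * Vᴴ) k k = Tr M / N` for every `k`. -/
theorem exists_unitary_constant_diagonal
    (N : ℕ) (M : Matrix (Fin N) (Fin N) ℂ) :
    ∃ V : Matrix (Fin N) (Fin N) ℂ,
      V * Vᴴ = 1 ∧ Vᴴ * V = 1 ∧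
        ∀ k : Fin N, (V * M * Vᴴ) k k = Matrix.trace M / (N : ℂ) := by
  -- A minimizer of the square sum of the diagonal has constant diagonal.
  obtain ⟨V, hV, hmin⟩ := (isCompact_setOf_mul_conjTranspose_eq_one (n := Fin N)).exists_isMinOn
    ⟨1, by simp⟩ (f := fun V => ∑ k, Complex.normSq ((V * M * Vᴴ) k k))
    (by
      have hc (k : Fin N) : Continuous fun V : Matrix (Fin N) (Fin N) ℂ => (V * M * Vᴴ) k k :=
        Continuous.matrix_elem (by fun_prop) k k
      exact (continuous_finsetSum _ fun k _ =>
        Complex.continuous_normSq.comp (hc k)).continuousOn)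
  have hV : V * Vᴴ = 1 := hV
  have hV' : Vᴴ * V = 1 := mul_eq_one_comm.1 hV
  have hconst (i j : Fin N) : (V * M * Vᴴ) i i = (V * M * Vᴴ) j j := by
    by_contra hne
    have hij : i ≠ j := fun h => hne (h ▸ rfl)
    obtain ⟨W, hW, hi, hj, hk⟩ := exists_unitary_average_diagonal M V hV hij
    have hle : ∑ k, Complex.normSq ((V * M * Vᴴ) k k) ≤ ∑ k, Complex.normSq ((W * M * Wᴴ) k k) :=
      hmin hW
    rw [← sub_nonneg, ← Finset.sum_sub_distrib, Fintype.sum_eq_add i j hij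
      (fun k h => by rw [hk k h.1 h.2, sub_self]), hi, hj] at hle
    have hpos := Complex.normSq_pos.2 (sub_ne_zero.2 hne)
    generalize (V * M * Vᴴ) i i = p at *
    generalize (V * M * Vᴴ) j j = q at *
    rw [show (p + q) / 2 = ((1 / 2 : ℝ) : ℂ) * (p + q) by push_cast; ring] at hle
    simp only [Complex.normSq_mul, Complex.normSq_ofReal] at hle
    simp only [Complex.normSq_apply, Complex.add_re, Complex.add_im, Complex.sub_re,
      Complex.sub_im] at hle hpos
    linarith
  refine ⟨V, hV, hV', fun k => ?_⟩
  have hN : (N : ℂ) ≠ 0 := Nat.cast_ne_zero.2 k.pos.ne'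
  have htr : trace (V * M * Vᴴ) = trace M := by
    rw [trace_mul_cycle, hV', Matrix.one_mul]
  rw [eq_div_iff hN, ← htr, trace]
  simp [hconst _ k, mul_comm]
end

section
/- If M is an N×N complex matrix with Tr(M) = 0, then there exists an N×N unitary matrix V such that every diagonal entry of V M V* is zero. -/
open Matrix

theorem exists_mul_cos_add_mul_sin_eq_zero (p q : ℝ) :
    ∃ t : ℝ, p * Real.cos t + q * Real.sin t = 0 := by
  refine ⟨Complex.arg ⟨q, -p⟩, ?_⟩
  have hc := Complex.norm_mul_cos_arg ⟨q, -p⟩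
  have hs := Complex.norm_mul_sin_arg ⟨q, -p⟩
  dsimp only at hc hs
  linear_combination Real.cos (Complex.arg ⟨q, -p⟩) * hs - Real.sin (Complex.arg ⟨q, -p⟩) * hc

/-- The two-dimensional case: there is a unit vector `(α, β)` at which the quadratic form of the
trace zero matrix `!![a, b; c, -a]` vanishes. -/
theorem exists_unit_quadratic_form_eq_zero {a : ℂ} (ha : a ≠ 0) (b c : ℂ) :
    ∃ α β : ℂ, α * star α + β * star β = 1 ∧
      a * (α * star α - β * star β) + α * star β * b + β * star α * c = 0 := by
  obtain ⟨t, ht⟩ := exists_mul_cos_add_mul_sin_eq_zero ((b + c) / a).im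
    (Complex.I * (c - b) / a).im
  set w : ℂ := (Real.cos t * (b + c) + Real.sin t * (Complex.I * (c - b))) / a with hw
  have hwim : w.im = 0 := by
    rw [← ht, hw, add_div, mul_div_assoc, mul_div_assoc, Complex.add_im, Complex.im_ofReal_mul,
      Complex.im_ofReal_mul]
    ring
  have hwre : w = (w.re : ℂ) := by
    apply Complex.ext <;> simp [hwim]
  have hwa : w * a = Real.cos t * (b + c) + Real.sin t * (Complex.I * (c - b)) :=
    div_mul_cancel₀ _ ha
  obtain ⟨s, hs⟩ := exists_mul_cos_add_mul_sin_eq_zero 2 w.re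
  have h2 : Real.cos s = Real.cos (s / 2) ^ 2 - Real.sin (s / 2) ^ 2 := by
    rw [← Real.cos_two_mul', mul_div_cancel₀ s two_ne_zero]
  have h3 : Real.sin s = 2 * Real.sin (s / 2) * Real.cos (s / 2) := by
    rw [← Real.sin_two_mul, mul_div_cancel₀ s two_ne_zero]
  rw [h2, h3] at hs
  have hs1 := Real.sin_sq_add_cos_sq (s / 2)
  have ht1 := Real.sin_sq_add_cos_sq t
  generalize Real.cos (s / 2) = x at *
  generalize Real.sin (s / 2) = y at *
  generalize Real.cos t = u at *
  generalize Real.sin t = v at *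
  have hsC : (2 : ℂ) * (x ^ 2 - y ^ 2) + w * (2 * y * x) = 0 := by
    rw [hwre]; exact_mod_cast hs
  have hs1C : (y : ℂ) ^ 2 + x ^ 2 = 1 := by exact_mod_cast hs1
  have ht1C : (v : ℂ) ^ 2 + u ^ 2 = 1 := by exact_mod_cast ht1
  have hI := Complex.I_sq
  refine ⟨x, y * (u + v * Complex.I), ?_, ?_⟩
  · simp only [Complex.star_def, map_mul, map_add, Complex.conj_ofReal, Complex.conj_I]
    linear_combination hs1C + (y : ℂ) ^ 2 * ht1C - (y : ℂ) ^ 2 * v ^ 2 * hI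
  · simp only [Complex.star_def, map_mul, map_add, Complex.conj_ofReal, Complex.conj_I]
    linear_combination a / 2 * hsC - (x : ℂ) * y * hwa - a * (y : ℂ) ^ 2 * ht1C
      + a * (y : ℂ) ^ 2 * v ^ 2 * hI

section

variable {n : Type*} [DecidableEq n]

/-- The matrix acting as `!![α, β; -star β, star α]` on the coordinates `j`, `k`
and trivially on the others. -/
def planeRotation (j k : n) (α β : ℂ) : Matrix n n ℂ :=
  of fun i => if i = j then Pi.single j α + Pi.single k β
    else if i = k then Pi.single j (-star β) + Pi.single k (star α) else Pi.single i 1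

theorem planeRotation_apply_left (j k : n) (α β : ℂ) :
    planeRotation j k α β j = Pi.single j α + Pi.single k β :=
  if_pos rfl

theorem planeRotation_apply_right {j k : n} (hjk : j ≠ k) (α β : ℂ) :
    planeRotation j k α β k = Pi.single j (-star β) + Pi.single k (star α) :=
  (if_neg hjk.symm).trans (if_pos rfl)

theorem planeRotation_apply_of_ne {i j k : n} (hij : i ≠ j) (hik : i ≠ k) (α β : ℂ) :
    planeRotation j k α β i = Pi.single i 1 :=
  (if_neg hij).trans (if_neg hik)

variable [Fintype n]

theorem planeRotation_mem_unitaryGroup {j k : n} (hjk : j ≠ k) {α β : ℂ}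
    (h : α * star α + β * star β = 1) : planeRotation j k α β ∈ unitaryGroup n ℂ := by
  rw [mem_unitaryGroup_iff]
  have hkj := hjk.symm
  simp only [Complex.star_def] at h
  ext p q
  change planeRotation j k α β p ⬝ᵥ star (planeRotation j k α β q) = _
  have hl := planeRotation_apply_left j k α β
  have hr := planeRotation_apply_right hjk α β
  rcases eq_or_ne p j with rfl | hpj
  · rcases eq_or_ne q p with rfl | hqp
    · simp [hl, hjk, hkj, h]
    rcases eq_or_ne q k with rfl | hqk
    · simp [hl, hr, hjk, hkj, mul_comm]
    · simp [hl, planeRotation_apply_of_ne hqp hqk, hqp.symm, hqk.symm]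
  rcases eq_or_ne p k with rfl | hpk
  · rcases eq_or_ne q j with rfl | hqj
    · simp [hl, hr, hjk, hkj, mul_comm]
    rcases eq_or_ne q p with rfl | hqp
    · simp [hr, hjk, hkj]
      linear_combination h
    · simp [hr, planeRotation_apply_of_ne hqj hqp, hqj.symm, hqp.symm]
  rw [planeRotation_apply_of_ne hpj hpk, single_one_dotProduct]
  rcases eq_or_ne q j with rfl | hqj
  · simp [hl, hpj, hpk]
  rcases eq_or_ne q k with rfl | hqk
  · simp [hr, hpj, hpk]
  · simp [planeRotation_apply_of_ne hqj hqk, one_apply, Pi.single_apply]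

theorem planeRotation_conj_apply_self {j k : n} (hjk : j ≠ k) (α β : ℂ) (A : Matrix n n ℂ) :
    (planeRotation j k α β * A * (planeRotation j k α β)ᴴ) j j =
      α * star α * A j j + α * star β * A j k + β * star α * A k j + β * star β * A k k ∧
    (planeRotation j k α β * A * (planeRotation j k α β)ᴴ) k k =
      β * star β * A j j - α * star β * A j k - β * star α * A k j + α * star α * A k k ∧
    ∀ i, i ≠ j → i ≠ k →
      (planeRotation j k α β * A * (planeRotation j k α β)ᴴ) i i = A i i := by
  have key (i : n) : (planeRotation j k α β * A * (planeRotation j k α β)ᴴ) i i =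
      (planeRotation j k α β i ᵥ* A) ⬝ᵥ star (planeRotation j k α β i) := rfl
  refine ⟨?_, ?_, fun i hij hik => ?_⟩
  · rw [key, planeRotation_apply_left]
    simp [add_vecMul]
    ring
  · rw [key, planeRotation_apply_right hjk]
    simp [add_vecMul]
    ring
  · rw [key, planeRotation_apply_of_ne hij hik]
    simp

theorem isCompact_unitaryGroup : IsCompact (unitaryGroup n ℂ : Set (Matrix n n ℂ)) := by
  have hsub : (unitaryGroup n ℂ : Set (Matrix n n ℂ)) ⊆
      Set.pi Set.univ fun _ => Set.pi Set.univ fun _ => Metric.closedBall (0 : ℂ) 1 := by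
    intro U hU i _ j _
    simpa using entry_norm_bound_of_unitary hU i j
  refine IsCompact.of_isClosed_subset
    (isCompact_univ_pi fun _ => isCompact_univ_pi fun _ => isCompact_closedBall 0 1) ?_ hsub
  have : (unitaryGroup n ℂ : Set (Matrix n n ℂ)) = {U | U * Uᴴ = 1} := by
    ext U
    exact mem_unitaryGroup_iff
  rw [this]
  exact isClosed_eq (by fun_prop) continuous_const

/-- If two diagonal entries differ, averaging them by a plane rotation decreases the sum of squared
moduli of the diagonal. -/
theorem exists_unitary_sum_normSq_diag_lt {A : Matrix n n ℂ} {j k : n} (h : A j j ≠ A k k) :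
    ∃ G ∈ unitaryGroup n ℂ,
      ∑ i, Complex.normSq ((G * A * Gᴴ) i i) < ∑ i, Complex.normSq (A i i) := by
  have hjk : j ≠ k := by rintro rfl; exact h rfl
  have ha : (A j j - A k k) / 2 ≠ 0 := div_ne_zero (sub_ne_zero.2 h) two_ne_zero
  obtain ⟨α, β, h1, h2⟩ := exists_unit_quadratic_form_eq_zero ha (A j k) (A k j)
  obtain ⟨hj, hk, hi⟩ := planeRotation_conj_apply_self hjk α β A
  refine ⟨planeRotation j k α β, planeRotation_mem_unitaryGroup hjk h1, ?_⟩
  have hj' : (planeRotation j k α β * A * (planeRotation j k α β)ᴴ) j j =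
      (A j j + A k k) / 2 := by
    rw [hj]; linear_combination h2 + (A j j + A k k) / 2 * h1
  have hk' : (planeRotation j k α β * A * (planeRotation j k α β)ᴴ) k k =
      (A j j + A k k) / 2 := by
    rw [hk]; linear_combination -h2 + (A j j + A k k) / 2 * h1
  rw [← sub_pos, ← Finset.sum_sub_distrib, Finset.sum_eq_add j k hjk
    (fun i _ hne => by rw [hi i hne.1 hne.2, sub_self]) (by simp) (by simp), hj', hk']
  have hpos := Complex.normSq_pos.2 ha
  have hpar : Complex.normSq (A j j) - Complex.normSq ((A j j + A k k) / 2) +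
      (Complex.normSq (A k k) - Complex.normSq ((A j j + A k k) / 2)) =
      2 * Complex.normSq ((A j j - A k k) / 2) := by
    simp only [map_div₀, Complex.normSq_add, Complex.normSq_sub]
    simp
    ring
  linarith

end

/-- If `M` is an `N × N` complex matrix with `Tr M = 0`, then
there is a unitary `V` such that every diagonal entry of `V * M * Vᴴ`
vanishes. -/
theorem exists_unitary_zero_diagonal_of_trace_zero
    (N : ℕ) (M : Matrix (Fin N) (Fin N) ℂ)
    (hM : Matrix.trace M = 0) :
    ∃ V : Matrix (Fin N) (Fin N) ℂ,
      V * Vᴴ = 1 ∧ Vᴴ * V = 1 ∧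
        ∀ k : Fin N, (V * M * Vᴴ) k k = 0 := by
  obtain ⟨V, hV, hmin⟩ := (isCompact_unitaryGroup (n := Fin N)).exists_isMinOn
    ⟨1, one_mem (unitaryGroup (Fin N) ℂ)⟩
    (f := fun V => ∑ i, Complex.normSq ((V * M * Vᴴ) i i))
    (Continuous.continuousOn (continuous_finsetSum _ fun i _ =>
      Complex.continuous_normSq.comp
        (Continuous.matrix_elem (by fun_prop) i i)))
  have hV1 : V * Vᴴ = 1 := mem_unitaryGroup_iff.1 hV
  have hV2 : Vᴴ * V = 1 := mem_unitaryGroup_iff'.1 hV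
  refine ⟨V, hV1, hV2, fun j => ?_⟩
  have heq (k : Fin N) : (V * M * Vᴴ) k k = (V * M * Vᴴ) j j := by
    by_contra hne
    obtain ⟨G, hG, hlt⟩ := exists_unitary_sum_normSq_diag_lt hne
    have hle := hmin (mul_mem hG hV)
    simp only [Set.mem_ofPred_eq, conjTranspose_mul] at hle
    simp only [Matrix.mul_assoc] at hle hlt
    exact hle.not_gt hlt
  have htr : trace (V * M * Vᴴ) = 0 := by
    rw [trace_mul_comm, ← Matrix.mul_assoc, hV2, Matrix.one_mul, hM]
  have hN : (N : ℂ) ≠ 0 := by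
    have := j.pos
    exact_mod_cast this.ne'
  rw [trace, Finset.sum_congr rfl fun k _ => (diag_apply _ k).trans (heq k)] at htr
  simpa [hN] using htr
end
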